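/- arXiv:2508.10258 — 4 statements merged into one kernel-verified Lean document; each statement's English description precedes it below -/
import Mathlib

section
/- Let ℓ : ℝ → ℝ be defined by ℓ(t) = ((t−1)(3t−4−√((t+2)(t−2))))/((t−1)²+(t−2)²), where √ denotes the real square root. Then ℓ is monotonically decreasing on the interval [2, ∞): for all real numbers s, t with 2 ≤ s ≤ t, one has ℓ(t) ≤ ℓ(s). -/
noncomputable def ell (t : ℝ) : ℝ :=
  ((t - 1) * (3 * t - 4 - Real.sqrt ((t + 2) * (t - 2)))) / ((t - 1) ^ 2 + (t - 2) ^ 2)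

theorem ell_aux (t : ℝ) (ht : 2 ≤ t) :
    ell t = 4 * (t - 1) / (3 * t - 4 + Real.sqrt ((t + 2) * (t - 2))) := by
  have h0 : 0 ≤ (t + 2) * (t - 2) := mul_nonneg (by linarith) (by linarith)
  have hr := Real.sq_sqrt h0
  have hn := Real.sqrt_nonneg ((t + 2) * (t - 2))
  unfold ell
  set r := Real.sqrt ((t + 2) * (t - 2))
  rw [div_eq_div_iff (by nlinarith) (by linarith)]
  linear_combination (-(t - 1)) * hr

theorem ell_antitoneOn :
    ∀ s t : ℝ, 2 ≤ s → s ≤ t → ell t ≤ ell s := by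
  intro s t hs hst
  have ht : 2 ≤ t := hs.trans hst
  rw [ell_aux s hs, ell_aux t ht]
  have hs0 : 0 ≤ (s + 2) * (s - 2) := mul_nonneg (by linarith) (by linarith)
  have ht0 : 0 ≤ (t + 2) * (t - 2) := mul_nonneg (by linarith) (by linarith)
  have ha := Real.sq_sqrt hs0
  have hb := Real.sq_sqrt ht0
  have ha0 := Real.sqrt_nonneg ((s + 2) * (s - 2))
  have hb0 := Real.sqrt_nonneg ((t + 2) * (t - 2))
  have ha2 : s - 2 ≤ Real.sqrt ((s + 2) * (s - 2)) := Real.le_sqrt_of_sq_le (by nlinarith)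
  have hb2 : t - 2 ≤ Real.sqrt ((t + 2) * (t - 2)) := Real.le_sqrt_of_sq_le (by nlinarith)
  set a := Real.sqrt ((s + 2) * (s - 2))
  set b := Real.sqrt ((t + 2) * (t - 2))
  have hab : a * b ≤ s * t - 4 := by
    apply abs_le_of_sq_le_sq' _ (by nlinarith) |>.2
    rw [mul_pow, ha, hb]
    nlinarith [sq_nonneg (s - t)]
  have key : (a - 1) * (t - 1) ≤ (b - 1) * (s - 1) := by
    rcases eq_or_lt_of_le hst with h | h
    · have : a = b := by simp only [a, b, h]
      rw [this, h]
    · have hbpos : 0 < b := Real.sqrt_pos.mpr (mul_pos (by linarith) (by linarith))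
      have e : (a + b) * ((b - 1) * (s - 1) - (a - 1) * (t - 1))
          = (t - s) * (t * s - a * b - t - s + a + b + 4) := by
        linear_combination (s - 1) * hb - (t - 1) * ha
      have h2 : 0 ≤ (t - s) * (t * s - a * b - t - s + a + b + 4) :=
        mul_nonneg (by linarith) (by linarith)
      rw [← e] at h2
      have := nonneg_of_mul_nonneg_right h2 (by linarith)
      linarith
  rw [div_le_div_iff₀ (by linarith) (by linarith)]
  nlinarith
end

section
/- Let ℓ : ℝ → ℝ be defined by ℓ(t) = ((t−1)(3t−4−√((t+2)(t−2))))/((t−1)²+(t−2)²), where √ denotes the real square root. Then ℓ(2) = 2, and for every real number t ≥ 2 one has ℓ(t) ≤ 2. -/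
theorem ell_two_eq_two_and_le_two :
    ell 2 = 2 ∧ ∀ t : ℝ, 2 ≤ t → ell t ≤ 2 := by
  constructor
  · norm_num [ell]
  · intro t ht
    have hs : t - 2 ≤ Real.sqrt ((t + 2) * (t - 2)) := by
      apply Real.le_sqrt_of_sq_le
      nlinarith
    have hd : 0 < (t - 1) ^ 2 + (t - 2) ^ 2 := by nlinarith [sq_nonneg (t - 2)]
    unfold ell
    rw [div_le_iff₀ hd]
    nlinarith [mul_le_mul_of_nonneg_left hs (by linarith : (0:ℝ) ≤ t - 1), sq_nonneg (t - 2)]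
end

section
/- Let n ≥ 3 be an integer, let Λ > 0 be real, and let R be a real number with 2Λ ≤ R ≤ u(n)Λ, where u(n) = ((n−1)(3n−4+√((n+2)(n−2))))/((n−1)²+(n−2)²). Setting W = (n−2)²/(4(n−1)²) and c = 8(n−1)²/(n−2)³, one has W·(√(R·(R + cΛ)) − R) − R/2 + Λ ≥ 0, where √ denotes the real square root. -/
noncomputable def uFun (t : ℝ) : ℝ :=
  ((t - 1) * (3 * t - 4 + Real.sqrt ((t + 2) * (t - 2)))) / ((t - 1) ^ 2 + (t - 2) ^ 2)

theorem P_nonneg (n : ℤ) (hn : 3 ≤ n) (Λ : ℝ) (hΛ : 0 < Λ) (R : ℝ)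
    (hR₁ : 2 * Λ ≤ R) (hR₂ : R ≤ uFun (n : ℝ) * Λ) :
    0 ≤ (((n : ℝ) - 2) ^ 2 / (4 * ((n : ℝ) - 1) ^ 2))
          * (Real.sqrt (R * (R + (8 * ((n : ℝ) - 1) ^ 2 / ((n : ℝ) - 2) ^ 3) * Λ)) - R)
        - R / 2 + Λ := by
  have ht : (3 : ℝ) ≤ (n : ℝ) := by exact_mod_cast hn
  generalize (n : ℝ) = t at *
  unfold uFun at hR₂
  have hs0 := Real.sqrt_nonneg ((t + 2) * (t - 2))
  have hs2 := Real.sq_sqrt (show 0 ≤ (t + 2) * (t - 2) by nlinarith)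
  generalize Real.sqrt ((t + 2) * (t - 2)) = s at *
  have hm : 0 < t - 2 := by linarith
  have ha : 0 < t - 1 := by linarith
  have hD : 0 < (t - 1) ^ 2 + (t - 2) ^ 2 := by positivity
  have hR : 0 < R := by linarith
  have hup : ((t - 1) ^ 2 + (t - 2) ^ 2) * R - (t - 1) * (3 * t - 4) * Λ ≤ (t - 1) * s * Λ := by
    rw [div_mul_eq_mul_div, le_div_iff₀ hD] at hR₂
    linarith
  have hlo : 0 ≤ ((t - 1) ^ 2 + (t - 2) ^ 2) * R - (t - 1) * (3 * t - 4) * Λ := by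
    have h1 := mul_le_mul_of_nonneg_left hR₁ hD.le
    have h2 : 0 ≤ (t - 2) * (t - 3) * Λ :=
      mul_nonneg (mul_nonneg hm.le (by linarith)) hΛ.le
    nlinarith
  have hsq := pow_le_pow_left₀ hlo hup 2
  have hq : ((t - 1) ^ 2 + (t - 2) ^ 2) * R ^ 2 - 2 * (t - 1) * (3 * t - 4) * R * Λ
      + 4 * (t - 1) ^ 2 * Λ ^ 2 ≤ 0 := by
    have h3 : ((t - 1) * s * Λ) ^ 2 = (t - 1) ^ 2 * ((t + 2) * (t - 2)) * Λ ^ 2 := by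
      rw [← hs2]; ring
    rw [h3] at hsq
    refine le_of_mul_le_mul_left (a := (t - 1) ^ 2 + (t - 2) ^ 2) ?_ hD
    linarith
  have hW : 0 < (t - 2) ^ 2 / (4 * (t - 1) ^ 2) := by positivity
  have key : ((t - 2) ^ 2 / (4 * (t - 1) ^ 2) * R + R / 2 - Λ) / ((t - 2) ^ 2 / (4 * (t - 1) ^ 2))
      ≤ Real.sqrt (R * (R + (8 * (t - 1) ^ 2 / (t - 2) ^ 3) * Λ)) := by
    apply Real.le_sqrt_of_sq_le
    rw [div_pow, div_le_iff₀ (by positivity), ← sub_nonneg]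
    have e : R * (R + (8 * (t - 1) ^ 2 / (t - 2) ^ 3) * Λ) * ((t - 2) ^ 2 / (4 * (t - 1) ^ 2)) ^ 2
        - ((t - 2) ^ 2 / (4 * (t - 1) ^ 2) * R + R / 2 - Λ) ^ 2
        = -(((t - 1) ^ 2 + (t - 2) ^ 2) * R ^ 2 - 2 * (t - 1) * (3 * t - 4) * R * Λ
      + 4 * (t - 1) ^ 2 * Λ ^ 2) / (4 * (t - 1) ^ 2) := by
      field_simp
      ring
    rw [e]
    apply div_nonneg <;> [linarith; positivity]
  rw [div_le_iff₀ hW] at key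
  linarith
end

section
/- Let n ≥ 3 be an integer, let Λ > 0 be real, and let x ≥ 0 be a real number. Set R = 2Λ + 2x, W = (n−2)²/(4(n−1)²), c = 8(n−1)²/(n−2)³, and s = √(R·(R + cΛ)), where √ denotes the real square root. If R ≤ u(n)Λ, where u(n) = ((n−1)(3n−4+√((n+2)(n−2))))/((n−1)²+(n−2)²), then (x + W·(s + R))·(W·(s − R) − x) ≥ 0. -/
theorem Fbar_product_nonneg (n : ℤ) (hn : 3 ≤ n) (Λ : ℝ) (hΛ : 0 < Λ)
    (x : ℝ) (hx : 0 ≤ x)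
    (hR : 2 * Λ + 2 * x ≤ uFun (n : ℝ) * Λ) :
    0 ≤ (x + (((n : ℝ) - 2) ^ 2 / (4 * ((n : ℝ) - 1) ^ 2))
            * (Real.sqrt ((2 * Λ + 2 * x)
                * ((2 * Λ + 2 * x) + (8 * ((n : ℝ) - 1) ^ 2 / ((n : ℝ) - 2) ^ 3) * Λ))
              + (2 * Λ + 2 * x)))
        * ((((n : ℝ) - 2) ^ 2 / (4 * ((n : ℝ) - 1) ^ 2))
            * (Real.sqrt ((2 * Λ + 2 * x)
                * ((2 * Λ + 2 * x) + (8 * ((n : ℝ) - 1) ^ 2 / ((n : ℝ) - 2) ^ 3) * Λ))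
              - (2 * Λ + 2 * x))
          - x) := by
  have ht : (3:ℝ) ≤ (n:ℝ) := by exact_mod_cast hn
  generalize (n:ℝ) = t at *
  unfold uFun at hR
  obtain ⟨k, rfl⟩ : ∃ k, t = k + 2 := ⟨t - 2, by ring⟩
  have hk : 1 ≤ k := by linarith
  have e1 : k + 2 - 2 = k := by ring
  have e2 : k + 2 - 1 = k + 1 := by ring
  rw [e1, e2] at hR ⊢
  have hk0 : 0 < k := by linarith
  have hq2 := Real.sq_sqrt (show 0 ≤ (k + 2 + 2) * k by positivity)
  have hqk : k ≤ Real.sqrt ((k + 2 + 2) * k) := Real.le_sqrt_of_sq_le (by nlinarith)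
  generalize Real.sqrt ((k + 2 + 2) * k) = q at *
  have hs2 := Real.sq_sqrt (show 0 ≤ (2 * Λ + 2 * x)
                * ((2 * Λ + 2 * x) + (8 * (k + 1) ^ 2 / k ^ 3) * Λ) by positivity)
  generalize Real.sqrt ((2 * Λ + 2 * x)
                * ((2 * Λ + 2 * x) + (8 * (k + 1) ^ 2 / k ^ 3) * Λ)) = s at *
  have hD : 0 < (k + 1) ^ 2 + k ^ 2 := by positivity
  rw [div_mul_eq_mul_div, le_div_iff₀ hD] at hR
  have h2 : 0 ≤ (2 * Λ + 2 * x) * ((k + 1) ^ 2 + k ^ 2)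
      - (k + 1) * (3 * (k + 2) - 4) * Λ + (k + 1) * q * Λ := by
    have a1 : 0 ≤ (k + 1) * (q - k) * Λ := by
      have := sub_nonneg.2 hqk
      positivity
    have a2 : 0 ≤ x * ((k + 1) ^ 2 + k ^ 2) := by positivity
    have a3 : 0 ≤ k ^ 2 * Λ := by positivity
    nlinarith
  have h3 := mul_nonneg (sub_nonneg.2 hR) h2
  have h4 : 0 ≤ ((k + 1) ^ 2 + k ^ 2) * (k * (2 * Λ + 2 * x) * Λ - 2 * (k + 1) ^ 2 * x ^ 2
      - k ^ 2 * x * (2 * Λ + 2 * x)) := by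
    linear_combination (1/2) * h3 + (1/2) * (k + 1) ^ 2 * Λ ^ 2 * hq2
  have h5 := nonneg_of_mul_nonneg_right h4 hD
  have h6 : 0 ≤ (k * (2 * Λ + 2 * x) * Λ - 2 * (k + 1) ^ 2 * x ^ 2
      - k ^ 2 * x * (2 * Λ + 2 * x)) / (2 * (k + 1) ^ 2) := by positivity
  have h7 : (x + k ^ 2 / (4 * (k + 1) ^ 2) * (s + (2 * Λ + 2 * x)))
      * (k ^ 2 / (4 * (k + 1) ^ 2) * (s - (2 * Λ + 2 * x)) - x)
      = (k ^ 2 / (4 * (k + 1) ^ 2)) ^ 2 * s ^ 2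
        - (x + k ^ 2 / (4 * (k + 1) ^ 2) * (2 * Λ + 2 * x)) ^ 2 := by ring
  rw [h7, hs2]
  refine h6.trans_eq ?_
  have : k + 1 ≠ 0 := by positivity
  field_simp
  ring
end
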